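/- arXiv:1610.06846 — 3 statements merged into one kernel-verified Lean document; each statement's English description precedes it below -/
import Mathlib

section
/- For every real m > 0, every real α > 2, and every real c > 0, the improper integral ∫₀^∞ 2r · (1 − (1 + c/(m·r^α))^{−m}) dr converges and equals (Γ(1 − 2/α) · Γ(m + 2/α) / Γ(m)) · (c/m)^{2/α}, where Γ denotes the real Gamma function. -/
open MeasureTheory Real Set

theorem lintegral_rpow_mul_exp_neg_mul_Ioi {a r : ℝ} (ha : 0 < a) (hr : 0 < r) :
    ∫⁻ t in Ioi (0 : ℝ), ENNReal.ofReal (t ^ (a - 1) * exp (-(r * t)))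
      = ENNReal.ofReal ((1 / r) ^ a * Real.Gamma a) := by
  have h := Real.integral_rpow_mul_exp_neg_mul_Ioi ha hr
  have hpos : 0 < (1 / r) ^ a * Real.Gamma a :=
    mul_pos (by positivity) (Real.Gamma_pos_of_pos ha)
  rw [← h, ofReal_integral_eq_lintegral_ofReal]
  · exact Integrable.of_integral_ne_zero (by rw [h]; exact hpos.ne')
  · filter_upwards [ae_restrict_mem measurableSet_Ioi] with t ht
    exact mul_nonneg (rpow_nonneg (le_of_lt ht) _) (exp_pos _).le

/-- The Beta integral of the second kind, with values in `ENNReal`. -/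
theorem lintegral_rpow_mul_one_add_rpow_neg {a b : ℝ} (ha : 0 < a) (hb : 0 < b) :
    ∫⁻ s in Ioi (0 : ℝ), ENNReal.ofReal (s ^ (a - 1) * (1 + s) ^ (-(a + b)))
      = ENNReal.ofReal (Real.Gamma a * Real.Gamma b / Real.Gamma (a + b)) := by
  have hab : 0 < a + b := add_pos ha hb
  have hΓ := Real.Gamma_pos_of_pos hab
  have hΓa := Real.Gamma_pos_of_pos ha
  have inner_t : ∀ s ∈ Ioi (0 : ℝ),
      ENNReal.ofReal (s ^ (a - 1) * (1 + s) ^ (-(a + b))) = ∫⁻ t in Ioi (0 : ℝ),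
        ENNReal.ofReal (Real.Gamma (a + b))⁻¹ *
          ENNReal.ofReal (s ^ (a - 1) * (t ^ (a + b - 1) * exp (-((1 + s) * t)))) := by
    intro s hs
    have hs : 0 < s := hs
    rw [lintegral_const_mul _ (by fun_prop)]
    simp_rw [ENNReal.ofReal_mul (rpow_nonneg hs.le (a - 1))]
    rw [lintegral_const_mul _ (by fun_prop),
      lintegral_rpow_mul_exp_neg_mul_Ioi hab (by positivity),
      ← ENNReal.ofReal_mul (by positivity), ← ENNReal.ofReal_mul (by positivity),
      ← ENNReal.ofReal_mul (by positivity), one_div, inv_rpow (by positivity),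
      rpow_neg (by positivity)]
    congr 1
    field_simp
  have inner_s : ∀ t ∈ Ioi (0 : ℝ), ∫⁻ s in Ioi (0 : ℝ),
        ENNReal.ofReal (Real.Gamma (a + b))⁻¹ *
          ENNReal.ofReal (s ^ (a - 1) * (t ^ (a + b - 1) * exp (-((1 + s) * t))))
      = ENNReal.ofReal (Real.Gamma a / Real.Gamma (a + b)) *
          ENNReal.ofReal (t ^ (b - 1) * exp (-(1 * t))) := by
    intro t ht
    have ht : 0 < t := ht
    rw [lintegral_const_mul _ (by fun_prop)]
    have e : ∀ s : ℝ, s ^ (a - 1) * (t ^ (a + b - 1) * exp (-((1 + s) * t)))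
        = (t ^ (a + b - 1) * exp (-(1 * t))) * (s ^ (a - 1) * exp (-(t * s))) := by
      intro s
      rw [show -((1 + s) * t) = -(1 * t) + -(t * s) by ring, exp_add]
      ring
    simp_rw [e, ENNReal.ofReal_mul (show 0 ≤ t ^ (a + b - 1) * exp (-(1 * t)) by positivity)]
    rw [lintegral_const_mul _ (by fun_prop), lintegral_rpow_mul_exp_neg_mul_Ioi ha ht,
      ← ENNReal.ofReal_mul (by positivity), ← ENNReal.ofReal_mul (by positivity),
      ← ENNReal.ofReal_mul (by positivity), one_div, inv_rpow ht.le,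
      show a + b - 1 = a + (b - 1) by ring, rpow_add ht]
    congr 1
    have := (rpow_pos_of_pos ht a).ne'
    field_simp
  rw [setLIntegral_congr_fun measurableSet_Ioi inner_t, lintegral_lintegral_swap (by fun_prop),
    setLIntegral_congr_fun measurableSet_Ioi inner_s, lintegral_const_mul _ (by fun_prop),
    lintegral_rpow_mul_exp_neg_mul_Ioi hb one_pos, ← ENNReal.ofReal_mul (by positivity)]
  congr 1
  simp
  ring

theorem one_sub_one_add_rpow_neg_eq_integral (m : ℝ) {x : ℝ} (hx : 0 ≤ x) :
    ∫ s in (0 : ℝ)..x, m * (1 + s) ^ (-(m + 1)) = 1 - (1 + x) ^ (-m) := by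
  have pos : ∀ s ∈ uIcc 0 x, 0 < 1 + s := fun s hs ↦ by
    rw [uIcc_of_le hx] at hs
    linarith [hs.1]
  rw [intervalIntegral.integral_eq_sub_of_hasDerivAt (f := fun s ↦ -(1 + s) ^ (-m))]
  · simp
    ring
  · intro s hs
    refine (((hasDerivAt_id s).const_add 1).rpow_const (p := -m)
      (Or.inl (pos s hs).ne')).neg.congr_deriv ?_
    simp only [id]
    rw [show -(m + 1) = -m - 1 by ring]
    ring
  · refine ContinuousOn.intervalIntegrable fun s hs ↦ ?_
    exact (((continuousAt_const.add continuousAt_id).rpow_const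
      (Or.inl (pos s hs).ne')).const_mul m).continuousWithinAt

theorem lintegral_one_sub_one_add_rpow_neg {m δ k : ℝ} (hm : 0 < m) (hδ : 0 < δ) (hδ1 : δ < 1)
    (hk : 0 < k) :
    ∫⁻ u in Ioi (0 : ℝ), ENNReal.ofReal (1 - (1 + k * u ^ (-δ⁻¹)) ^ (-m))
      = ENNReal.ofReal (Real.Gamma (1 - δ) * Real.Gamma (m + δ) / Real.Gamma m * k ^ δ) := by
  have layer := lintegral_comp_eq_lintegral_meas_le_mul (volume.restrict (Ioi (0 : ℝ)))
    (f := fun u ↦ k * u ^ (-δ⁻¹)) (g := fun s ↦ m * (1 + s) ^ (-(m + 1)))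
    (by
      filter_upwards [ae_restrict_mem measurableSet_Ioi] with u hu
      exact mul_nonneg hk.le (rpow_nonneg (le_of_lt hu) _))
    (by fun_prop)
    (fun t ht ↦ by
      refine ContinuousOn.intervalIntegrable fun s hs ↦ ?_
      rw [uIcc_of_le ht.le] at hs
      exact (((continuousAt_const.add continuousAt_id).rpow_const
        (Or.inl ((show 0 < 1 + s by linarith [hs.1]).ne'))).const_mul m).continuousWithinAt)
    (by
      filter_upwards [ae_restrict_mem measurableSet_Ioi] with s hs
      have hs : 0 < s := hs
      positivity)
  have left : ∀ u ∈ Ioi (0 : ℝ), ENNReal.ofReal (1 - (1 + k * u ^ (-δ⁻¹)) ^ (-m))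
      = ENNReal.ofReal (∫ s in (0 : ℝ)..k * u ^ (-δ⁻¹), m * (1 + s) ^ (-(m + 1))) := by
    intro u hu
    have hu : 0 < u := hu
    rw [one_sub_one_add_rpow_neg_eq_integral m (by positivity)]
  have right : ∀ s ∈ Ioi (0 : ℝ),
      volume.restrict (Ioi (0 : ℝ)) {u | s ≤ k * u ^ (-δ⁻¹)} *
          ENNReal.ofReal (m * (1 + s) ^ (-(m + 1)))
        = ENNReal.ofReal (k ^ δ * m) *
          ENNReal.ofReal (s ^ ((1 - δ) - 1) * (1 + s) ^ (-((1 - δ) + (m + δ)))) := by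
    intro s hs
    have hs : 0 < s := hs
    have level : {u | s ≤ k * u ^ (-δ⁻¹)} ∩ Ioi (0 : ℝ) = Ioc 0 ((k / s) ^ δ) := by
      ext u
      simp only [mem_inter_iff, mem_ofPred_eq, mem_Ioi, mem_Ioc]
      rw [and_comm]
      refine and_congr_right fun hu ↦ ?_
      rw [rpow_neg hu.le, ← div_eq_mul_inv, le_div_iff₀ (by positivity), mul_comm,
        ← le_div_iff₀ hs, rpow_inv_le_iff_of_pos hu.le (by positivity) hδ]
    rw [Measure.restrict_apply' measurableSet_Ioi, level, Real.volume_Ioc, sub_zero,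
      ← ENNReal.ofReal_mul (by positivity), ← ENNReal.ofReal_mul (by positivity),
      div_rpow hk.le hs.le, show (1 - δ) - 1 = -δ by ring, rpow_neg hs.le,
      show (1 - δ) + (m + δ) = m + 1 by ring]
    congr 1
    ring
  rw [setLIntegral_congr_fun measurableSet_Ioi left, layer,
    setLIntegral_congr_fun measurableSet_Ioi right, lintegral_const_mul _ (by fun_prop),
    lintegral_rpow_mul_one_add_rpow_neg (by linarith) (by linarith),
    ← ENNReal.ofReal_mul (by positivity), show (1 - δ) + (m + δ) = m + 1 by ring,
    Real.Gamma_add_one hm.ne']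
  congr 1
  have := (Real.Gamma_pos_of_pos hm).ne'
  field_simp

theorem integrable_and_integral_eq_of_lintegral_eq_ofReal {X : Type*} [MeasurableSpace X]
    {μ : Measure X} {f : X → ℝ} {v : ℝ} (hf : AEStronglyMeasurable f μ) (h0 : 0 ≤ᵐ[μ] f)
    (hv : 0 ≤ v) (h : ∫⁻ x, ENNReal.ofReal (f x) ∂μ = ENNReal.ofReal v) :
    Integrable f μ ∧ ∫ x, f x ∂μ = v := by
  refine ⟨⟨hf, ?_⟩, ?_⟩
  · rw [hasFiniteIntegral_iff_ofReal h0, h]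
    exact ENNReal.ofReal_lt_top
  · rw [integral_eq_lintegral_of_nonneg_ae h0 hf, h, ENNReal.toReal_ofReal hv]

theorem interference_exponent_nakagami
    (m α c : ℝ) (hm : 0 < m) (hα : 2 < α) (hc : 0 < c) :
    IntegrableOn (fun r : ℝ => 2 * r * (1 - (1 + c / (m * r ^ α)) ^ (-m)))
      (Set.Ioi (0:ℝ)) ∧
    ∫ r in Set.Ioi (0:ℝ), 2 * r * (1 - (1 + c / (m * r ^ α)) ^ (-m))
      = (Real.Gamma (1 - 2 / α) * Real.Gamma (m + 2 / α) / Real.Gamma m)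
          * (c / m) ^ (2 / α) := by
  have hα0 : 0 < α := by linarith
  have hδ : 0 < 2 / α := by positivity
  have hδ1 : 2 / α < 1 := (div_lt_one hα0).2 hα
  have hΓ := Real.Gamma_pos_of_pos (sub_pos.2 hδ1)
  have hΓ' := Real.Gamma_pos_of_pos hm
  have hΓ'' := Real.Gamma_pos_of_pos (add_pos hm hδ)
  obtain ⟨hint, hval⟩ := integrable_and_integral_eq_of_lintegral_eq_ofReal
    (Measurable.aestronglyMeasurable (by fun_prop))
    (by
      filter_upwards [ae_restrict_mem measurableSet_Ioi] with u hu
      have hu : 0 < u := hu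
      have h1 : 1 ≤ 1 + c / m * u ^ (-(2 / α)⁻¹) := le_add_of_nonneg_right (by positivity)
      exact sub_nonneg.2 (rpow_le_one_of_one_le_of_nonpos h1 (by linarith)))
    (by positivity)
    (lintegral_one_sub_one_add_rpow_neg hm hδ hδ1 (div_pos hc hm))
  have subst : ∀ r ∈ Ioi (0 : ℝ),
      (|2| * r ^ ((2 : ℝ) - 1)) • (1 - (1 + c / m * (r ^ (2 : ℝ)) ^ (-(2 / α)⁻¹)) ^ (-m))
        = 2 * r * (1 - (1 + c / (m * r ^ α)) ^ (-m)) := by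
    intro r hr
    have hr : 0 < r := hr
    have e : c / m * (r ^ (2 : ℝ)) ^ (-(2 / α)⁻¹) = c / (m * r ^ α) := by
      rw [← rpow_mul hr.le, show (2 : ℝ) * -(2 / α)⁻¹ = -α by field_simp, rpow_neg hr.le]
      field_simp
    rw [e, abs_two, show (2 : ℝ) - 1 = 1 by norm_num, rpow_one, smul_eq_mul]
  constructor
  · exact ((integrableOn_Ioi_comp_rpow_iff _ two_ne_zero).2 hint).congr_fun subst measurableSet_Ioi
  · exact (setIntegral_congr_fun measurableSet_Ioi subst).symm.trans
      ((integral_comp_rpow_Ioi _ two_ne_zero).trans hval)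
end

section
/- For every real φ with 0 < φ ≤ 1, ∫₀^∞ 4 / ((1 + φ·s²) · (2s − 2·arctan(s) + π)) ds ≤ (π·φ^{3/2} + (2π/(3√3))·(1 − 2φ) − ln(φ)) / (φ² − φ + 1). -/
open MeasureTheory Real Set

theorem div_one_add_le_arctan {x : ℝ} (hx : 0 ≤ x) : x / (1 + x) ≤ arctan x := by
  have hd : ∀ y : ℝ, 0 ≤ y → HasDerivAt (fun y => arctan y - y / (1 + y))
      (1 / (1 + y ^ 2) - (1 * (1 + y) - y * 1) / (1 + y) ^ 2) y := fun y hy =>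
    (hasDerivAt_arctan y).sub
      ((hasDerivAt_id y).div ((hasDerivAt_id y).const_add 1) (by positivity))
  have hmono : MonotoneOn (fun y => arctan y - y / (1 + y)) (Ici 0) := by
    refine monotoneOn_of_deriv_nonneg (convex_Ici 0)
      (fun y hy => (hd y hy).continuousAt.continuousWithinAt)
      (fun y hy => ?_) (fun y hy => ?_) <;> rw [interior_Ici] at hy
    · exact (hd y (le_of_lt hy)).differentiableAt.differentiableWithinAt
    · have hy' : 0 < y := hy
      rw [(hd y hy'.le).deriv, sub_nonneg, show 1 * (1 + y) - y * 1 = (1 : ℝ) by ring]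
      exact one_div_le_one_div_of_le (by positivity) (by nlinarith)
  have h := hmono (mem_Ici.2 le_rfl) (mem_Ici.2 hx) hx
  simp only [arctan_zero, zero_div, sub_zero] at h
  linarith

theorem inv_one_add_le_pi_div_two_sub_arctan {s : ℝ} (hs : 0 < s) :
    1 / (1 + s) ≤ π / 2 - arctan s := by
  rw [← arctan_inv_of_pos hs]
  convert div_one_add_le_arctan (inv_pos.2 hs).le using 1
  field_simp
  ring

/-- An antiderivative, up to the factor `r ^ 4 - r ^ 2 + 1`, of
`2 * (s + 1) / ((1 + r ^ 2 * s ^ 2) * (s ^ 2 + s + 1))`. -/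
noncomputable def ratePrimitive (r s : ℝ) : ℝ :=
  log (s ^ 2 + s + 1) - log (1 + r ^ 2 * s ^ 2) + 2 * r ^ 3 * arctan (r * s)
    + (1 - 2 * r ^ 2) * (2 / √3) * arctan ((2 * s + 1) / √3)

theorem hasDerivAt_ratePrimitive (r s : ℝ) :
    HasDerivAt (ratePrimitive r)
      ((r ^ 4 - r ^ 2 + 1) * (2 * (s + 1) / ((1 + r ^ 2 * s ^ 2) * (s ^ 2 + s + 1)))) s := by
  have hq : 0 < s ^ 2 + s + 1 := by nlinarith [sq_nonneg (s + 1 / 2)]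
  have hp : 0 < 1 + r ^ 2 * s ^ 2 := by positivity
  have h1 : HasDerivAt (fun s : ℝ => s ^ 2 + s + 1) (2 * s + 1) s := by
    simpa using ((hasDerivAt_pow 2 s).add (hasDerivAt_id s)).add_const 1
  have h2 : HasDerivAt (fun s : ℝ => 1 + r ^ 2 * s ^ 2) (r ^ 2 * (2 * s)) s := by
    simpa using ((hasDerivAt_pow 2 s).const_mul (r ^ 2)).const_add 1
  have h3 : HasDerivAt (fun s : ℝ => r * s) r s := by
    simpa using (hasDerivAt_id s).const_mul r
  have h4 : HasDerivAt (fun s : ℝ => (2 * s + 1) / √3) (2 / √3) s := by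
    simpa using (((hasDerivAt_id s).const_mul 2).add_const 1).div_const (√3)
  have h := (((h1.log hq.ne').sub (h2.log hp.ne')).add (h3.arctan.const_mul (2 * r ^ 3))).add
    (h4.arctan.const_mul ((1 - 2 * r ^ 2) * (2 / √3)))
  refine h.congr_deriv ?_
  have h3sq : √3 ^ 2 = (3 : ℝ) := sq_sqrt (by norm_num)
  have e : (1 - 2 * r ^ 2) * (2 / √3) * (1 / (1 + ((2 * s + 1) / √3) ^ 2) * (2 / √3))
      = (1 - 2 * r ^ 2) / (s ^ 2 + s + 1) := by
    have : 1 + ((2 * s + 1) / √3) ^ 2 = 4 / 3 * (s ^ 2 + s + 1) := by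
      rw [div_pow, h3sq]; ring
    rw [this]
    have : (2 / √3) * (2 / √3) = (4 / 3 : ℝ) := by
      rw [div_mul_div_comm, ← sq √3, h3sq]; norm_num
    calc _ = (1 - 2 * r ^ 2) * ((2 / √3) * (2 / √3)) * (1 / (4 / 3 * (s ^ 2 + s + 1))) := by ring
      _ = _ := by rw [this]; field_simp
  rw [e, mul_pow]
  have hq' : s * (s + 1) + 1 ≠ 0 := by nlinarith
  field_simp
  ring

theorem tendsto_ratePrimitive {r : ℝ} (hr : 0 < r) :
    Filter.Tendsto (ratePrimitive r) Filter.atTop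
      (nhds (-log (r ^ 2) + 2 * r ^ 3 * (π / 2) + (1 - 2 * r ^ 2) * (2 / √3) * (π / 2))) := by
  have harc : Filter.Tendsto arctan Filter.atTop (nhds (π / 2)) :=
    tendsto_arctan_atTop.mono_right nhdsWithin_le_nhds
  have hinv := tendsto_inv_atTop_zero (𝕜 := ℝ)
  have h1 : Filter.Tendsto (fun s : ℝ => log (s ^ 2 + s + 1) - log (1 + r ^ 2 * s ^ 2))
      Filter.atTop (nhds (-log (r ^ 2))) := by
    have hn : Filter.Tendsto (fun s : ℝ => 1 + s⁻¹ + s⁻¹ ^ 2) Filter.atTop (nhds 1) := by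
      simpa using (hinv.const_add 1).add (hinv.pow 2)
    have hd : Filter.Tendsto (fun s : ℝ => s⁻¹ ^ 2 + r ^ 2) Filter.atTop (nhds (r ^ 2)) := by
      simpa using (hinv.pow 2).add_const (r ^ 2)
    have h := (hn.log one_ne_zero).sub (hd.log (by positivity))
    rw [log_one, zero_sub] at h
    refine h.congr' ?_
    filter_upwards [Filter.eventually_gt_atTop 0] with s hs
    rw [← log_div (by positivity) (by positivity), ← log_div (by positivity) (by positivity)]
    congr 1
    field_simp
  have h2 : Filter.Tendsto (fun s : ℝ => arctan (r * s)) Filter.atTop (nhds (π / 2)) :=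
    harc.comp (Filter.tendsto_id.const_mul_atTop hr)
  have h3 : Filter.Tendsto (fun s : ℝ => arctan ((2 * s + 1) / √3)) Filter.atTop
      (nhds (π / 2)) :=
    harc.comp ((Filter.tendsto_atTop_add_const_right _ 1
      (Filter.tendsto_id.const_mul_atTop two_pos)).atTop_div_const (by positivity))
  exact (h1.add (h2.const_mul _)).add (h3.const_mul _)

theorem ratePrimitive_zero (r : ℝ) :
    ratePrimitive r 0 = (1 - 2 * r ^ 2) * (2 / √3) * (π / 6) := by
  have h : arctan (1 / √3) = π / 6 := by
    rw [← tan_pi_div_six]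
    exact arctan_tan (by linarith [pi_pos]) (by linarith [pi_pos])
  simp only [ratePrimitive, mul_zero, zero_add, h]
  simp

theorem rate_closed_form_upper_bound (φ : ℝ) (hφ0 : 0 < φ) (hφ1 : φ ≤ 1) :
    ∫ s in Set.Ioi (0:ℝ), 4 / ((1 + φ * s ^ 2) * (2 * s - 2 * Real.arctan s + π))
      ≤ (π * φ ^ ((3:ℝ) / 2) + (2 * π / (3 * Real.sqrt 3)) * (1 - 2 * φ)
          - Real.log φ) / (φ ^ 2 - φ + 1) := by
  obtain ⟨r, hr, rfl⟩ : ∃ r : ℝ, 0 < r ∧ φ = r ^ 2 :=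
    ⟨√φ, sqrt_pos.2 hφ0, (sq_sqrt hφ0.le).symm⟩
  have hpow : (r ^ 2) ^ ((3 : ℝ) / 2) = r ^ 3 := by
    rw [← rpow_natCast r 2, ← rpow_mul hr.le, ← rpow_natCast r 3]
    norm_num
  have hD : 0 < r ^ 4 - r ^ 2 + 1 := by nlinarith [sq_nonneg (r ^ 2 - 1 / 2)]
  have hderiv : ∀ s ∈ Ici (0 : ℝ), HasDerivAt (fun s => ratePrimitive r s / (r ^ 4 - r ^ 2 + 1))
      (2 * (s + 1) / ((1 + r ^ 2 * s ^ 2) * (s ^ 2 + s + 1))) s := fun s _ =>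
    ((hasDerivAt_ratePrimitive r s).div_const _).congr_deriv (mul_div_cancel_left₀ _ hD.ne')
  have hnonneg : ∀ s ∈ Ioi (0 : ℝ),
      0 ≤ 2 * (s + 1) / ((1 + r ^ 2 * s ^ 2) * (s ^ 2 + s + 1)) := fun s hs => by
    have hs : 0 < s := hs
    positivity
  have hlim := (tendsto_ratePrimitive hr).div_const (r ^ 4 - r ^ 2 + 1)
  have hint := integrableOn_Ioi_deriv_of_nonneg' hderiv
    hnonneg hlim
  have hval := integral_Ioi_of_hasDerivAt_of_nonneg' hderiv
    hnonneg hlim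
  have hden : ∀ s : ℝ, 0 < s →
      2 * (s ^ 2 + s + 1) / (s + 1) ≤ 2 * s - 2 * arctan s + π := fun s hs => by
    have h := inv_one_add_le_pi_div_two_sub_arctan hs
    have e : 2 * (s ^ 2 + s + 1) / (s + 1) = 2 * s + 2 * (1 / (1 + s)) := by
      field_simp
      ring
    linarith
  calc _ ≤ ∫ s in Ioi (0 : ℝ), 2 * (s + 1) / ((1 + r ^ 2 * s ^ 2) * (s ^ 2 + s + 1)) := by
        refine integral_mono_of_nonneg ?_ hint ?_ <;>
          filter_upwards [ae_restrict_mem measurableSet_Ioi] with s hs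
        · have hs : 0 < s := hs
          have : 0 < 2 * s - 2 * arctan s + π := lt_of_lt_of_le (by positivity) (hden s hs)
          simp only [Pi.zero_apply]
          positivity
        · have hs : 0 < s := hs
          calc _ ≤ 4 / ((1 + r ^ 2 * s ^ 2) * (2 * (s ^ 2 + s + 1) / (s + 1))) := by
                gcongr
                exact hden s hs
            _ = _ := by
                field_simp
                norm_num
    _ = _ := by
        rw [hval, ratePrimitive_zero, hpow, ← sub_div]
        congr 1
        · field_simp
          ring
        · ring
end

section
/- Fix a real u > 0. The function R : (0, ∞) → ℝ defined by R(λ) = ∫₀^∞ 4 / ((1 + (1 − e^{−u/λ})·s²) · (2s − 2·arctan(s) + π)) ds is strictly monotonically increasing in λ. -/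
open MeasureTheory Real Set

theorem Real.arctan_lt_self_of_pos {s : ℝ} (hs : 0 < s) : arctan s < s := by
  simpa [tan_arctan] using lt_tan (arctan_pos.2 hs) (arctan_lt_pi_div_two s)

theorem Real.pi_le_two_mul_sub_arctan_add_pi {s : ℝ} (hs : 0 < s) :
    π ≤ 2 * s - 2 * arctan s + π := by
  linarith [arctan_lt_self_of_pos hs]

theorem integrable_inv_one_add_mul_sq {p : ℝ} (hp : 0 < p) :
    Integrable fun s : ℝ => (1 + p * s ^ 2)⁻¹ := by
  simpa [mul_pow, sq_sqrt hp.le] using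
    integrable_inv_one_add_sq.comp_mul_left' (sqrt_pos.2 hp).ne'

theorem integrableOn_rate_integrand {p : ℝ} (hp : 0 < p) :
    IntegrableOn (fun s : ℝ => 4 / ((1 + p * s ^ 2) * (2 * s - 2 * arctan s + π)))
      (Ioi 0) := by
  refine Integrable.mono' (((integrable_inv_one_add_mul_sq hp).const_mul (4 / π)).integrableOn)
    (Measurable.aestronglyMeasurable (by fun_prop)) ?_
  filter_upwards [ae_restrict_mem measurableSet_Ioi] with s hs
  have hq := pi_le_two_mul_sub_arctan_add_pi hs
  have hq' := pi_pos.trans_le hq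
  rw [norm_of_nonneg (by positivity), ← div_eq_mul_inv, div_div, mul_comm]
  gcongr

theorem setIntegral_lt_setIntegral_of_forall_lt {α : Type*} [MeasurableSpace α] {μ : Measure α}
    {t : Set α} {f g : α → ℝ} (ht : MeasurableSet t) (hμ : μ t ≠ 0)
    (hf : IntegrableOn f t μ) (hg : IntegrableOn g t μ) (h : ∀ x ∈ t, f x < g x) :
    ∫ x in t, f x ∂μ < ∫ x in t, g x ∂μ := by
  rw [← sub_pos, ← integral_sub' hg hf,
    setIntegral_pos_iff_support_of_nonneg_ae _ (hg.sub hf)]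
  · refine (pos_iff_ne_zero.2 hμ).trans_le (measure_mono fun x hx => ⟨?_, hx⟩)
    exact (sub_pos.2 (h x hx)).ne'
  · filter_upwards [ae_restrict_mem ht] with x hx
    exact (sub_pos.2 (h x hx)).le

theorem rate_strictMono_in_density (u : ℝ) (hu : 0 < u) :
    StrictMonoOn
      (fun lam : ℝ => ∫ s in Set.Ioi (0:ℝ),
        4 / ((1 + (1 - Real.exp (-(u / lam))) * s ^ 2)
              * (2 * s - 2 * Real.arctan s + π)))
      (Set.Ioi (0:ℝ)) := by
  have active_pos {lam : ℝ} (hlam : 0 < lam) : 0 < 1 - exp (-(u / lam)) := by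
    simpa using div_pos hu hlam
  intro a ha b hb hab
  have hpa := active_pos ha
  have hpb := active_pos hb
  refine setIntegral_lt_setIntegral_of_forall_lt measurableSet_Ioi (by simp)
    (integrableOn_rate_integrand hpa) (integrableOn_rate_integrand hpb) fun s hs => ?_
  have hs' : 0 < s := hs
  have hq := pi_pos.trans_le (pi_le_two_mul_sub_arctan_add_pi hs)
  gcongr
end
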